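/- For all T, λ > 0, all x ∈ ℝ² with x ≠ 0, and all 0 ≤ s < t ≤ T, one has the ℝ²-valued (Bochner) integral identity ∫_{ℝ²} d_{s,t}^{T,λ}(x,y) · Υ_{T−t}^λ(y) dy = Υ_{T−s}^λ(x), where d_{s,t}^{T,λ}(x,y) = f_{t−s}^λ(x,y) · (1 + H_{T−t}^λ(y)) / (1 + H_{T−s}^λ(x)) and Υ_r^λ(y) = y / (1 + H_r^λ(y)) for y ≠ 0, with Υ_r^λ(0) = 0 (the value of the integrand at y = 0 is irrelevant since {0} is Lebesgue-null). -/

import Mathlib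

open MeasureTheory Real

/-- The Volterra function `ν(x) = ∫₀^∞ x^s / Γ(s+1) ds` (for `x > 0`; `ν(0) = 0`). -/
noncomputable def volterra (x : ℝ) : ℝ := ∫ s in Set.Ioi (0 : ℝ), x ^ s / Real.Gamma (s + 1)

/-- The derivative of the Volterra function: `ν′(x) = ∫₀^∞ s x^{s−1} / Γ(s+1) ds` for `x > 0`. -/
noncomputable def volterraDeriv (x : ℝ) : ℝ :=
  ∫ s in Set.Ioi (0 : ℝ), s * x ^ (s - 1) / Real.Gamma (s + 1)

/-- The two-dimensional Gaussian density `g_t(x) = (1/(2πt)) e^{−|x|²/(2t)}`. -/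
noncomputable def gauss2 (t : ℝ) (x : EuclideanSpace ℝ (Fin 2)) : ℝ :=
  (1 / (2 * Real.pi * t)) * Real.exp (-(‖x‖ ^ 2 / (2 * t)))

/-- The kernel `h_t^λ(x,y) = 2πλ ∫∫_{0<r<s<t} g_r(x) ν′((s−r)λ) g_{t−s}(y) ds dr`. -/
noncomputable def hKer (t lam : ℝ) (x y : EuclideanSpace ℝ (Fin 2)) : ℝ :=
  2 * Real.pi * lam *
    ∫ r in Set.Ioo (0 : ℝ) t, ∫ s in Set.Ioo r t,
      gauss2 r x * volterraDeriv ((s - r) * lam) * gauss2 (t - s) y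

/-- The kernel `f_t^λ(x,y) = g_t(x−y) + h_t^λ(x,y)`. -/
noncomputable def fKer (t lam : ℝ) (x y : EuclideanSpace ℝ (Fin 2)) : ℝ :=
  gauss2 t (x - y) + hKer t lam x y

/-- `H_t^λ(x) = ∫₀^t (e^{−|x|²/(2r)}/r) ν((t−r)λ) dr` (equal to `0` when `t = 0`). -/
noncomputable def Hfun (t lam : ℝ) (x : EuclideanSpace ℝ (Fin 2)) : ℝ :=
  ∫ r in (0 : ℝ)..t, Real.exp (-(‖x‖ ^ 2 / (2 * r))) / r * volterra ((t - r) * lam)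

/-- The transition density `d_{s,t}^{T,λ}(x,y) = f_{t−s}^λ(x,y)(1+H_{T−t}^λ(y))/(1+H_{T−s}^λ(x))`. -/
noncomputable def dKer (T lam s t : ℝ) (x y : EuclideanSpace ℝ (Fin 2)) : ℝ :=
  fKer (t - s) lam x y * (1 + Hfun (T - t) lam y) / (1 + Hfun (T - s) lam x)

/-- `Υ_r^λ(y) = y / (1 + H_r^λ(y))` for `y ≠ 0`, with `Υ_r^λ(0) = 0`. -/
noncomputable def Upsilon (r lam : ℝ) (y : EuclideanSpace ℝ (Fin 2)) : EuclideanSpace ℝ (Fin 2) :=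
  (1 / (1 + Hfun r lam y)) • y

lemma continuous_inv_Gamma_add_one : Continuous fun s : ℝ => (Real.Gamma (s + 1))⁻¹ := by
  have h : Continuous fun s : ℝ => ((Complex.Gamma ((s + 1 : ℝ) : ℂ))⁻¹).re :=
    Complex.continuous_re.comp (Complex.differentiable_one_div_Gamma.continuous.comp
      (Complex.continuous_ofReal.comp (continuous_id.add continuous_const)))
  refine h.congr fun s => ?_
  rw [Complex.Gamma_ofReal, ← Complex.ofReal_inv, Complex.ofReal_re]

lemma rpow_mul_exp_neg_le_Gamma_add_one {s M : ℝ} (hs : 0 < s) (hM : 0 ≤ M) :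
    M ^ s * exp (-M) ≤ Real.Gamma (s + 1) := by
  have hint := Real.GammaIntegral_convergent (s := s + 1) (by linarith)
  rw [Real.Gamma_eq_integral (by linarith), ← integral_exp_neg_Ioi, ← integral_const_mul]
  calc ∫ u in Set.Ioi M, M ^ s * exp (-u)
      ≤ ∫ u in Set.Ioi M, exp (-u) * u ^ (s + 1 - 1) := by
        refine setIntegral_mono_on ((integrableOn_exp_neg_Ioi M).const_mul _)
          (hint.mono_set (Set.Ioi_subset_Ioi hM)) measurableSet_Ioi fun u hu => ?_
        rw [mul_comm, add_sub_cancel_right]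
        gcongr
        exact le_of_lt hu
    _ ≤ _ := setIntegral_mono_set hint
        ((ae_restrict_iff' measurableSet_Ioi).2 <| ae_of_all _ fun u hu => by
          have : (0 : ℝ) < u := hu
          show 0 ≤ exp (-u) * u ^ (s + 1 - 1)
          positivity)
        (Set.Ioi_subset_Ioi hM).eventuallyLE

lemma rpow_div_Gamma_add_one_le {s a : ℝ} (hs : 0 < s) (ha : 0 < a) :
    a ^ s / Real.Gamma (s + 1) ≤ exp (a * exp 1) * exp (-s) := by
  have h := rpow_mul_exp_neg_le_Gamma_add_one (M := a * exp 1) hs (by positivity)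
  rw [div_le_iff₀ (Real.Gamma_pos_of_pos (by linarith))]
  calc a ^ s = exp (a * exp 1) * exp (-s) * ((a * exp 1) ^ s * exp (-(a * exp 1))) := by
        rw [mul_rpow ha.le (exp_pos _).le, ← exp_mul, one_mul, exp_neg, exp_neg]
        field_simp
    _ ≤ _ := by gcongr

lemma measurable_volterraDeriv_integrand (lam : ℝ) :
    Measurable fun p : ℝ × ℝ => p.2 * (p.1 * lam) ^ (p.2 - 1) / Real.Gamma (p.2 + 1) := by
  simp only [div_eq_mul_inv]
  have := continuous_inv_Gamma_add_one.measurable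
  exact (by fun_prop : Measurable fun p : ℝ × ℝ => p.2 * (p.1 * lam) ^ (p.2 - 1)).mul
    (this.comp measurable_snd)

lemma measurable_volterraDeriv : Measurable volterraDeriv := by
  have h := (measurable_volterraDeriv_integrand 1).stronglyMeasurable.integral_prod_right'
    (ν := volume.restrict (Set.Ioi (0 : ℝ)))
  simp only [mul_one] at h
  exact h.measurable

lemma lintegral_volterraDeriv_integrand {a lam s : ℝ} (ha : 0 < a) (hlam : 0 < lam)
    (hs : 0 < s) :
    ∫⁻ u in Set.Ioo 0 a, ‖s * (u * lam) ^ (s - 1) / Real.Gamma (s + 1)‖ₑ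
      = ENNReal.ofReal (lam⁻¹ * ((a * lam) ^ s / Real.Gamma (s + 1))) := by
  have hG := Real.Gamma_pos_of_pos (show 0 < s + 1 by linarith)
  have hint : IntegrableOn (fun u : ℝ => u ^ (s - 1)) (Set.Ioo 0 a) :=
    (intervalIntegral.integrableOn_Ioo_rpow_iff ha).2 (by linarith)
  have hc : 0 ≤ s * lam ^ (s - 1) / Real.Gamma (s + 1) := by positivity
  calc _ = ∫⁻ u in Set.Ioo 0 a,
          ENNReal.ofReal (s * lam ^ (s - 1) / Real.Gamma (s + 1) * u ^ (s - 1)) := by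
        refine setLIntegral_congr_fun measurableSet_Ioo fun u hu => ?_
        have hu0 : 0 < u := hu.1
        rw [← ofReal_norm, Real.norm_of_nonneg (by positivity),
          mul_rpow hu0.le hlam.le]
        congr 1
        ring
    _ = _ := by
        rw [← ofReal_integral_eq_lintegral_ofReal (hint.const_mul _)
          ((ae_restrict_iff' measurableSet_Ioo).2 <| ae_of_all _ fun u hu =>
            mul_nonneg hc (rpow_nonneg hu.1.le _)),
          integral_const_mul, ← integral_Ioc_eq_integral_Ioo,
          ← intervalIntegral.integral_of_le ha.le, integral_rpow (Or.inl (by linarith)),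
          sub_add_cancel, zero_rpow hs.ne', sub_zero, mul_rpow ha.le hlam.le,
          rpow_sub_one hlam.ne']
        congr 1
        field_simp

lemma lintegral_enorm_volterraDeriv_lt_top {a lam : ℝ} (ha : 0 < a) (hlam : 0 < lam) :
    ∫⁻ u in Set.Ioo 0 a, ‖volterraDeriv (u * lam)‖ₑ < ⊤ := by
  have hfin : ∫⁻ s in Set.Ioi (0 : ℝ),
      ENNReal.ofReal (lam⁻¹ * (exp (a * lam * exp 1) * exp (-s))) < ⊤ :=
    (((integrableOn_exp_neg_Ioi 0).const_mul _).const_mul _).lintegral_lt_top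
  refine lt_of_le_of_lt ?_ hfin
  calc _ ≤ ∫⁻ u in Set.Ioo 0 a, ∫⁻ s in Set.Ioi (0 : ℝ),
          ‖s * (u * lam) ^ (s - 1) / Real.Gamma (s + 1)‖ₑ :=
        lintegral_mono fun u => enorm_integral_le_lintegral_enorm _
    _ = ∫⁻ s in Set.Ioi (0 : ℝ), ∫⁻ u in Set.Ioo 0 a,
          ‖s * (u * lam) ^ (s - 1) / Real.Gamma (s + 1)‖ₑ :=
        lintegral_lintegral_swap (measurable_volterraDeriv_integrand lam).enorm.aemeasurable
    _ ≤ _ := by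
        refine setLIntegral_mono' measurableSet_Ioi fun s hs => ?_
        rw [lintegral_volterraDeriv_integrand ha hlam hs]
        gcongr
        exact rpow_div_Gamma_add_one_le hs (by positivity)

lemma gauss2_nonneg {t : ℝ} (ht : 0 ≤ t) (x : EuclideanSpace ℝ (Fin 2)) : 0 ≤ gauss2 t x := by
  unfold gauss2; positivity

lemma gauss2_neg (t : ℝ) (x : EuclideanSpace ℝ (Fin 2)) : gauss2 t (-x) = gauss2 t x := by
  simp [gauss2]

lemma measurable_gauss2 :
    Measurable fun p : ℝ × EuclideanSpace ℝ (Fin 2) => gauss2 p.1 p.2 := by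
  unfold gauss2; fun_prop

lemma gauss2_le_of_ne_zero {r : ℝ} (hr : 0 < r) {x : EuclideanSpace ℝ (Fin 2)} (hx : x ≠ 0) :
    gauss2 r x ≤ 1 / (π * ‖x‖ ^ 2) := by
  have hx' : 0 < ‖x‖ := norm_pos_iff.2 hx
  have h := Real.add_one_le_exp (‖x‖ ^ 2 / (2 * r))
  rw [gauss2, exp_neg, ← div_eq_mul_inv, div_div]
  refine one_div_le_one_div_of_le (by positivity) ?_
  calc π * ‖x‖ ^ 2 = 2 * π * r * (‖x‖ ^ 2 / (2 * r)) := by field_simp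
    _ ≤ _ := by gcongr; linarith

lemma integral_exp_neg_mul_sq_norm_fin_two {b : ℝ} (hb : 0 < b) :
    ∫ y : EuclideanSpace ℝ (Fin 2), exp (-b * ‖y‖ ^ 2) = π / b := by
  rw [GaussianFourier.integral_rexp_neg_mul_sq_norm hb]
  simp

lemma integrable_exp_neg_mul_sq_norm_fin_two {b : ℝ} (hb : 0 < b) :
    Integrable fun y : EuclideanSpace ℝ (Fin 2) => exp (-b * ‖y‖ ^ 2) := by
  refine Integrable.of_integral_ne_zero ?_
  rw [integral_exp_neg_mul_sq_norm_fin_two hb]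
  positivity

lemma gauss2_eq (t : ℝ) (y : EuclideanSpace ℝ (Fin 2)) :
    gauss2 t y = 1 / (2 * π * t) * exp (-(1 / (2 * t)) * ‖y‖ ^ 2) := by
  rw [gauss2]; congr 2; ring

lemma integrable_gauss2 {t : ℝ} (ht : 0 < t) : Integrable (gauss2 t) := by
  rw [funext (gauss2_eq t)]
  exact (integrable_exp_neg_mul_sq_norm_fin_two (by positivity)).const_mul _

lemma integral_gauss2 {t : ℝ} (ht : 0 < t) : ∫ y, gauss2 t y = 1 := by
  simp_rw [gauss2_eq]
  rw [integral_const_mul, integral_exp_neg_mul_sq_norm_fin_two (by positivity)]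
  field_simp

lemma gauss2_mul_norm_le {t : ℝ} (ht : 0 < t) (y : EuclideanSpace ℝ (Fin 2)) :
    gauss2 t y * ‖y‖ ≤ 4 * √t * gauss2 (2 * t) y := by
  have hle : ‖y‖ ≤ 2 * √t * exp (‖y‖ ^ 2 / (2 * (2 * t))) := by
    have h := Real.add_one_le_exp (‖y‖ ^ 2 / (2 * (2 * t)))
    have hs := Real.sqrt_pos.2 ht
    have hsq : √t ^ 2 = t := Real.sq_sqrt ht.le
    have h2 : ‖y‖ ^ 2 / (2 * (2 * t)) = (‖y‖ / (2 * √t)) ^ 2 := by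
      rw [div_pow, mul_pow, hsq]; ring
    rw [h2] at h ⊢
    have h3 : ‖y‖ / (2 * √t) ≤ exp ((‖y‖ / (2 * √t)) ^ 2) := by
      nlinarith [sq_nonneg (‖y‖ / (2 * √t) - 1)]
    rw [div_le_iff₀ (by positivity)] at h3
    linarith
  have hexp : exp (-(‖y‖ ^ 2 / (2 * t))) * exp (‖y‖ ^ 2 / (2 * (2 * t)))
      = exp (-(‖y‖ ^ 2 / (2 * (2 * t)))) := by
    rw [← exp_add]; congr 1; field_simp; ring
  calc gauss2 t y * ‖y‖
      ≤ gauss2 t y * (2 * √t * exp (‖y‖ ^ 2 / (2 * (2 * t)))) := by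
        gcongr; exact gauss2_nonneg ht.le y
    _ = 1 / (2 * π * t) * (2 * √t) *
          (exp (-(‖y‖ ^ 2 / (2 * t))) * exp (‖y‖ ^ 2 / (2 * (2 * t)))) := by
        rw [gauss2]; ring
    _ = 4 * √t * gauss2 (2 * t) y := by
        rw [hexp, gauss2]; field_simp; ring

lemma integrable_gauss2_smul {t : ℝ} (ht : 0 < t) :
    Integrable fun y : EuclideanSpace ℝ (Fin 2) => gauss2 t y • y := by
  refine ((integrable_gauss2 (t := 2 * t) (by positivity)).const_mul (4 * √t)).mono'
    ((integrable_gauss2 ht).aestronglyMeasurable.smul aestronglyMeasurable_id) ?_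
  refine ae_of_all _ fun y => ?_
  rw [norm_smul, Real.norm_of_nonneg (gauss2_nonneg ht.le y)]
  exact gauss2_mul_norm_le ht y

lemma lintegral_gauss2_mul_enorm_le {t : ℝ} (ht : 0 < t) :
    ∫⁻ y, ‖gauss2 t y‖ₑ * ‖y‖ₑ ≤ ENNReal.ofReal (4 * √t) := by
  calc _ ≤ ∫⁻ y, ENNReal.ofReal (4 * √t * gauss2 (2 * t) y) := by
        refine lintegral_mono fun y => ?_
        rw [← ofReal_norm, ← ofReal_norm, ← ENNReal.ofReal_mul (norm_nonneg _),
          Real.norm_of_nonneg (gauss2_nonneg ht.le y)]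
        exact ENNReal.ofReal_le_ofReal (gauss2_mul_norm_le ht y)
    _ = _ := by
        rw [← ofReal_integral_eq_lintegral_ofReal
          ((integrable_gauss2 (by positivity)).const_mul _)
          (ae_of_all _ fun y => mul_nonneg (by positivity) (gauss2_nonneg (by positivity) y)),
          integral_const_mul, integral_gauss2 (by positivity), mul_one]

lemma integral_smul_self_eq_zero_of_even {k : EuclideanSpace ℝ (Fin 2) → ℝ}
    (hk : ∀ y, k (-y) = k y) : ∫ y, k y • y = 0 := by
  have h := integral_neg_eq_self (fun y => k y • y) volume
  simp only [hk, smul_neg, integral_neg] at h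
  have h2 : (2 : ℝ) • ∫ y, k y • y = 0 := by
    rw [two_smul]
    nth_rewrite 1 [← h]
    exact neg_add_cancel _
  exact (smul_eq_zero.1 h2).resolve_left two_ne_zero

lemma integrable_gauss2_sub_smul {t : ℝ} (ht : 0 < t) (x : EuclideanSpace ℝ (Fin 2)) :
    Integrable fun y => gauss2 t (x - y) • y := by
  have h := (((integrable_gauss2 ht).smul_const x).sub (integrable_gauss2_smul ht)).comp_sub_left x
  refine h.congr (ae_of_all _ fun y => ?_)
  simp [← smul_sub]

lemma integral_gauss2_sub_smul {t : ℝ} (ht : 0 < t) (x : EuclideanSpace ℝ (Fin 2)) :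
    ∫ y, gauss2 t (x - y) • y = x := by
  rw [← integral_sub_left_eq_self _ volume x]
  simp only [sub_sub_cancel, smul_sub]
  rw [integral_sub ((integrable_gauss2 ht).smul_const x) (integrable_gauss2_smul ht),
    integral_smul_const, integral_gauss2 ht, one_smul,
    integral_smul_self_eq_zero_of_even (gauss2_neg t), sub_zero]

/-- The integrand of `hKer`, extended by zero off `r < s < t`. -/
noncomputable def hKerIntegrand (t lam : ℝ) (x y : EuclideanSpace ℝ (Fin 2)) (r s : ℝ) : ℝ :=
  (Set.Ioo r t).indicator
    (fun s => gauss2 r x * volterraDeriv ((s - r) * lam) * gauss2 (t - s) y) s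

lemma hKer_eq (t lam : ℝ) (x y : EuclideanSpace ℝ (Fin 2)) :
    hKer t lam x y =
      2 * π * lam * ∫ r in Set.Ioo (0 : ℝ) t, ∫ s, hKerIntegrand t lam x y r s := by
  simp only [hKer, hKerIntegrand, integral_indicator measurableSet_Ioo]

lemma hKer_neg (t lam : ℝ) (x y : EuclideanSpace ℝ (Fin 2)) :
    hKer t lam x (-y) = hKer t lam x y := by
  simp only [hKer, gauss2_neg]

lemma measurable_hKerIntegrand (t lam : ℝ) (x : EuclideanSpace ℝ (Fin 2)) :
    Measurable fun p : (EuclideanSpace ℝ (Fin 2) × ℝ) × ℝ =>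
      hKerIntegrand t lam x p.1.1 p.1.2 p.2 := by
  have h1 : Measurable fun p : (EuclideanSpace ℝ (Fin 2) × ℝ) × ℝ => gauss2 p.1.2 x :=
    measurable_gauss2.comp (by fun_prop :
      Measurable fun p : (EuclideanSpace ℝ (Fin 2) × ℝ) × ℝ => (p.1.2, x))
  have h2 : Measurable fun p : (EuclideanSpace ℝ (Fin 2) × ℝ) × ℝ =>
      volterraDeriv ((p.2 - p.1.2) * lam) := measurable_volterraDeriv.comp (by fun_prop)
  have h3 : Measurable fun p : (EuclideanSpace ℝ (Fin 2) × ℝ) × ℝ => gauss2 (t - p.2) p.1.1 :=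
    measurable_gauss2.comp (by fun_prop :
      Measurable fun p : (EuclideanSpace ℝ (Fin 2) × ℝ) × ℝ => (t - p.2, p.1.1))
  have hS : MeasurableSet {p : (EuclideanSpace ℝ (Fin 2) × ℝ) × ℝ | p.2 ∈ Set.Ioo p.1.2 t} :=
    (measurableSet_lt (measurable_snd.comp measurable_fst) measurable_snd).inter
      (measurableSet_lt measurable_snd measurable_const)
  exact ((h1.mul h2).mul h3).indicator hS

lemma measurable_hKer (t lam : ℝ) (x : EuclideanSpace ℝ (Fin 2)) :
    Measurable (hKer t lam x) := by
  rw [funext (hKer_eq t lam x)]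
  exact ((measurable_hKerIntegrand t lam x).stronglyMeasurable.integral_prod_right'
    (ν := volume)).integral_prod_right' (ν := volume.restrict (Set.Ioo 0 t))
    |>.measurable.const_mul _

lemma lintegral_hKerIntegrand_le {t lam : ℝ} {x : EuclideanSpace ℝ (Fin 2)} (hx : x ≠ 0)
    {r : ℝ} (hr : r ∈ Set.Ioo 0 t) (s : ℝ) :
    ∫⁻ y, ‖hKerIntegrand t lam x y r s‖ₑ * ‖y‖ₑ ≤
      ENNReal.ofReal (1 / (π * ‖x‖ ^ 2)) * ENNReal.ofReal (4 * √t) *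
        (Set.Ioo 0 t).indicator (fun u => ‖volterraDeriv (u * lam)‖ₑ) (s - r) := by
  by_cases hs : s ∈ Set.Ioo r t
  · have hmem : s - r ∈ Set.Ioo 0 t := ⟨sub_pos.2 hs.1, by linarith [hs.2, hr.1]⟩
    have hts : 0 < t - s := sub_pos.2 hs.2
    simp only [hKerIntegrand, Set.indicator_of_mem hs, Set.indicator_of_mem hmem, enorm_mul,
      mul_assoc]
    rw [lintegral_const_mul' _ _ enorm_ne_top, lintegral_const_mul' _ _ enorm_ne_top,
      mul_comm (ENNReal.ofReal (4 * √t))]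
    gcongr
    · rw [← ofReal_norm, Real.norm_of_nonneg (gauss2_nonneg hr.1.le x)]
      exact ENNReal.ofReal_le_ofReal (gauss2_le_of_ne_zero hr.1 hx)
    · refine (lintegral_gauss2_mul_enorm_le hts).trans ?_
      gcongr
      linarith [hs.1, hr.1]
  · simp [hKerIntegrand, hs]

lemma integrable_hKer_smul {t lam : ℝ} (ht : 0 < t) (hlam : 0 < lam)
    {x : EuclideanSpace ℝ (Fin 2)} (hx : x ≠ 0) :
    Integrable fun y => hKer t lam x y • y := by
  refine ⟨((measurable_hKer t lam x).smul measurable_id).aestronglyMeasurable, ?_⟩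
  have hK := (measurable_hKerIntegrand t lam x).enorm
  have hKy : Measurable fun p : (EuclideanSpace ℝ (Fin 2) × ℝ) × ℝ =>
      ‖hKerIntegrand t lam x p.1.1 p.1.2 p.2‖ₑ * ‖p.1.1‖ₑ := hK.mul (by fun_prop)
  set C := ENNReal.ofReal (1 / (π * ‖x‖ ^ 2)) * ENNReal.ofReal (4 * √t)
  have hCtop : C ≠ ⊤ := ENNReal.mul_ne_top ENNReal.ofReal_ne_top ENNReal.ofReal_ne_top
  set V := ∫⁻ u in Set.Ioo 0 t, ‖volterraDeriv (u * lam)‖ₑ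
  have hV : V < ⊤ := lintegral_enorm_volterraDeriv_lt_top ht hlam
  have hbound : ∫⁻ y, ∫⁻ r in Set.Ioo 0 t, ∫⁻ s, ‖hKerIntegrand t lam x y r s‖ₑ * ‖y‖ₑ
      ≤ ∫⁻ _ in Set.Ioo 0 t, C * V := by
    rw [lintegral_lintegral_swap hKy.lintegral_prod_right'.aemeasurable]
    refine setLIntegral_mono' measurableSet_Ioo fun r hr => ?_
    have hKr : Measurable fun p : EuclideanSpace ℝ (Fin 2) × ℝ =>
        ‖hKerIntegrand t lam x p.1 r p.2‖ₑ * ‖p.1‖ₑ :=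
      hKy.comp (by fun_prop :
        Measurable fun p : EuclideanSpace ℝ (Fin 2) × ℝ => ((p.1, r), p.2))
    rw [lintegral_lintegral_swap hKr.aemeasurable]
    refine (lintegral_mono fun s => lintegral_hKerIntegrand_le hx hr s).trans ?_
    rw [lintegral_const_mul' _ _ hCtop, lintegral_sub_right_eq_self,
      lintegral_indicator measurableSet_Ioo]
  refine lt_of_le_of_lt (b := ∫⁻ y, ‖2 * π * lam‖ₑ *
    ∫⁻ r in Set.Ioo 0 t, ∫⁻ s, ‖hKerIntegrand t lam x y r s‖ₑ * ‖y‖ₑ) ?_ ?_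
  · refine lintegral_mono fun y => ?_
    have h1 : ‖∫ r in Set.Ioo (0 : ℝ) t, ∫ s, hKerIntegrand t lam x y r s‖ₑ ≤
        ∫⁻ r in Set.Ioo 0 t, ∫⁻ s, ‖hKerIntegrand t lam x y r s‖ₑ :=
      (enorm_integral_le_lintegral_enorm _).trans
        (lintegral_mono fun _ => enorm_integral_le_lintegral_enorm _)
    simp only [lintegral_mul_const' _ _ (enorm_ne_top (x := y))]
    rw [enorm_smul, hKer_eq, enorm_mul, mul_assoc]
    gcongr
  · rw [lintegral_const_mul' _ _ enorm_ne_top]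
    refine ENNReal.mul_lt_top enorm_lt_top (hbound.trans_lt ?_)
    rw [setLIntegral_const]
    exact ENNReal.mul_lt_top (ENNReal.mul_lt_top hCtop.lt_top hV) (by simp)

lemma volterra_nonneg {a : ℝ} (ha : 0 ≤ a) : 0 ≤ volterra a :=
  setIntegral_nonneg measurableSet_Ioi fun s hs => by
    have : 0 < s := hs
    exact div_nonneg (rpow_nonneg ha _) (Real.Gamma_pos_of_pos (by linarith)).le

lemma Hfun_nonneg {t lam : ℝ} (ht : 0 ≤ t) (hlam : 0 ≤ lam) (x : EuclideanSpace ℝ (Fin 2)) :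
    0 ≤ Hfun t lam x :=
  intervalIntegral.integral_nonneg ht fun _ hr =>
    mul_nonneg (div_nonneg (exp_pos _).le hr.1)
      (volterra_nonneg (mul_nonneg (sub_nonneg.2 hr.2) hlam))

lemma integral_fKer_smul {t lam : ℝ} (ht : 0 < t) (hlam : 0 < lam)
    {x : EuclideanSpace ℝ (Fin 2)} (hx : x ≠ 0) :
    ∫ y, fKer t lam x y • y = x := by
  simp only [fKer, add_smul]
  rw [integral_add (integrable_gauss2_sub_smul ht x) (integrable_hKer_smul ht hlam hx),
    integral_gauss2_sub_smul ht, integral_smul_self_eq_zero_of_even (hKer_neg t lam x), add_zero]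

/-- For all `T, λ > 0`, nonzero `x ∈ ℝ²`, and `0 ≤ s < t ≤ T`, one has the Bochner integral
identity `∫_{ℝ²} d_{s,t}^{T,λ}(x,y) Υ_{T−t}^λ(y) dy = Υ_{T−s}^λ(x)`. -/
theorem dKer_Upsilon_martingale_identity (T lam s t : ℝ) (hT : 0 < T) (hlam : 0 < lam)
    (hs : 0 ≤ s) (hst : s < t) (htT : t ≤ T)
    (x : EuclideanSpace ℝ (Fin 2)) (hx : x ≠ 0) :
    (∫ y : EuclideanSpace ℝ (Fin 2), dKer T lam s t x y • Upsilon (T - t) lam y)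
      = Upsilon (T - s) lam x := by
  have h (y : EuclideanSpace ℝ (Fin 2)) : dKer T lam s t x y • Upsilon (T - t) lam y =
      (1 / (1 + Hfun (T - s) lam x)) • (fKer (t - s) lam x y • y) := by
    have hH := Hfun_nonneg (sub_nonneg.2 htT) hlam.le y
    rw [dKer, Upsilon, smul_smul, smul_smul]
    congr 1
    field_simp
  simp only [h]
  rw [integral_smul, integral_fKer_smul (sub_pos.2 hst) hlam hx, Upsilon]
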